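/- Tensorized representation of the centered variance term: in the Feynman-Kac setting, for any n ≥ 0, any 0 ≤ p ≤ n, any bounded measurable F_n : X^{n+1} → R and any x ∈ X with D_{p,n}(1)(x) > 0 and η_p(D_{p,n}(1)) > 0, one has the identity P_{p,n}(F_n)(x) − η_p(D_{p,n}(F_n))/η_p(D_{p,n}(1)) = (δ_x ⊗ η_p − η_p ⊗ δ_x)(D̄_{p,n}(F_n ⊗ 1)) / (η_p(D_{p,n}(1)) · D_{p,n}(1)(x)), where D̄_{p,n} = D_{p,n} ⊗ D_{p,n} and (F_n ⊗ 1)(x_{0:n}, y_{0:n}) = F_n(x_{0:n}). -/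

import Mathlib

open MeasureTheory ENNReal Filter Topology

noncomputable section

namespace FK

variable {X : Type} [MeasurableSpace X]
variable (lam mu : Measure X) (G : ℕ → X → ℝ) (H : ℕ → X → X → ℝ)

/-- The one-step Feynman-Kac operator `Q_n(f)(x) = G_{n-1}(x) ∫ H_n(x,y) f(y) λ(dy)` (`n ≥ 1`). -/
def Qop (n : ℕ) (f : X → ℝ) (x : X) : ℝ :=
  G (n - 1) x * ∫ y, H n x y * f y ∂lam

/-- The semigroup `Q_{p,p+k}`. -/
def QsegAux (p : ℕ) : ℕ → (X → ℝ) → X → ℝ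
  | 0, f => f
  | k + 1, f => QsegAux p k (Qop lam G H (p + k + 1) f)

/-- The semigroup `Q_{p,n}` (identity when `n ≤ p`). -/
def Qseg (p n : ℕ) (f : X → ℝ) : X → ℝ := QsegAux lam G H p (n - p) f

/-- The unnormalized Feynman-Kac measures `γ_n`. -/
def gammaM : ℕ → Measure X
  | 0 => mu
  | n + 1 =>
      ((gammaM n).withDensity fun x => ENNReal.ofReal (G n x)).bind
        fun x => lam.withDensity fun y => ENNReal.ofReal (H (n + 1) x y)

/-- The predictor `η_n = γ_n/γ_n(1)`. -/
def eta (n : ℕ) : Measure X := (gammaM lam mu G H n Set.univ)⁻¹ • gammaM lam mu G H n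

/-- `η_n(f)`. -/
def etaI (n : ℕ) (f : X → ℝ) : ℝ := ∫ x, f x ∂(eta lam mu G H n)

/-- `h_{p,n} = Q_{p,n}(1)/η_p(Q_{p,n}(1))`. -/
def hfun (p n : ℕ) (x : X) : ℝ :=
  Qseg lam G H p n (fun _ => 1) x / etaI lam mu G H p (Qseg lam G H p n fun _ => 1)

/-- The backward kernel `M_{q,η_{q-1}}` acting on a function. -/
def Mback (q : ℕ) (f : X → ℝ) (x : X) : ℝ :=
  (∫ y, G (q - 1) y * H q y x * f y ∂(eta lam mu G H (q - 1))) /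
    ∫ y, G (q - 1) y * H q y x ∂(eta lam mu G H (q - 1))

/-- `M_{q+k:q}` (iterated backward kernels). -/
def MbackAux (q : ℕ) : ℕ → (X → ℝ) → X → ℝ
  | 0, f => f
  | k + 1, f => Mback lam mu G H (q + k + 1) (MbackAux q k f)

/-- `M_{p:q} = M_{p,η_{p-1}} ⋯ M_{q+1,η_q}`. -/
def MbackSeg (p q : ℕ) (f : X → ℝ) : X → ℝ := MbackAux lam mu G H q (p - q) f

/-- Integration of a function of `(x_0,…,x_{n-1})` with respect to the backward path kernel
`\mathcal{M}_n(x_n, dx_{0:n-1})` built from the measure sequence `etaSeq`. -/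
def Bpath (etaSeq : ℕ → Measure X) : (n : ℕ) → X → ((Fin n → X) → ℝ) → ℝ
  | 0, _, F => F fun i => i.elim0
  | n + 1, x, F =>
      (∫ y, G n y * H (n + 1) y x * Bpath etaSeq n y (fun z => F (Fin.snoc z y)) ∂(etaSeq n)) /
        ∫ y, G n y * H (n + 1) y x ∂(etaSeq n)

/-- Integration of a function of `(x_{p+1},…,x_{p+k})` with respect to the forward path kernel
`\mathcal{Q}_{p,p+k}(x_p, dx_{p+1:p+k})`. -/
def Fpath : (p : ℕ) → (k : ℕ) → X → ((Fin k → X) → ℝ) → ℝ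
  | _, 0, _, F => F fun i => i.elim0
  | p, k + 1, x, F =>
      G p x * ∫ y, H (p + 1) x y * Fpath (p + 1) k y (fun z => F (Fin.cons y z)) ∂lam

/-- The operator `D_{p,n}` (with the measure sequence `etaSeq` used in the backward kernels):
`D_{p,n}(F)(x_p) = ∫ \mathcal{M}_p(x_p,dx_{0:p-1}) \mathcal{Q}_{p,n}(x_p,dx_{p+1:n}) F(x_{0:n})`. -/
def Dop (etaSeq : ℕ → Measure X) (p n : ℕ) (F : (Fin (n + 1) → X) → ℝ) (x : X) : ℝ :=
  if h : p ≤ n then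
    Bpath G H etaSeq p x fun back =>
      Fpath lam G H p (n - p) x fun fwd =>
        F fun i => Fin.append (Fin.snoc back x) fwd (Fin.cast (by omega) i)
  else 0

/-- The smoother `∫ F(x_{0:n}) outer(dx_n) \mathcal{M}_n(x_n, dx_{0:n-1})`. -/
def smoother (etaSeq : ℕ → Measure X) (outer : Measure X) (n : ℕ)
    (F : (Fin (n + 1) → X) → ℝ) : ℝ :=
  ∫ x, Bpath G H etaSeq n x (fun back => F (Fin.snoc back x)) ∂outer

/-- The asymptotic variance `σ_n²(F_n)`. -/
def sigmaSq (n : ℕ) (F : (Fin (n + 1) → X) → ℝ) : ℝ :=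
  ∑ p ∈ Finset.range (n + 1),
    ∫ x,
      (hfun lam mu G H p n x *
          (Dop lam G H (eta lam mu G H) p n F x /
              Dop lam G H (eta lam mu G H) p n (fun _ => 1) x -
            etaI lam mu G H p (Dop lam G H (eta lam mu G H) p n F) /
              etaI lam mu G H p (Dop lam G H (eta lam mu G H) p n fun _ => 1))) ^ 2
      ∂(eta lam mu G H p)

/-- Empirical measure of a particle configuration. -/
def emp (N : ℕ) (c : Fin N → X) : Measure X :=
  ((N : ℝ≥0∞))⁻¹ • ∑ i : Fin N, Measure.dirac (c i)

/-- The selection/mutation operator `Φ_p(μ) = μ(G_{p-1}M_p)/μ(G_{p-1})`. -/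
def PhiMeas (p : ℕ) (μ : Measure X) : Measure X :=
  (∫⁻ x, ENNReal.ofReal (G (p - 1) x) ∂μ)⁻¹ •
    ((μ.withDensity fun x => ENNReal.ofReal (G (p - 1) x)).bind
      fun x => lam.withDensity fun y => ENNReal.ofReal (H p x y))

/-- The joint law of the particle system `(x_0^{1:N},…,x_n^{1:N})`. -/
def particleLaw (N : ℕ) : (n : ℕ) → Measure (Fin (n + 1) → Fin N → X)
  | 0 => (Measure.pi fun _ : Fin N => mu).map fun c => fun _ : Fin 1 => c
  | n + 1 =>
      (particleLaw N n).bind fun traj =>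
        (Measure.pi fun _ : Fin N =>
            PhiMeas lam G H (n + 1) (emp N (traj (Fin.last n)))).map
          fun c => Fin.snoc traj c

/-- The sequence of empirical measures `η_q^N` extracted from a particle trajectory. -/
def empSeq (N n : ℕ) (traj : Fin (n + 1) → Fin N → X) (q : ℕ) : Measure X :=
  if h : q < n + 1 then emp N (traj ⟨q, h⟩) else 0

/-- Expectation along the doubled (tensorized) inhomogeneous Markov chain started at time `p`
from the point `z ∈ X²`, over the path `(X̄_p,…,X̄_{p+k})`. -/
def chainE : (p : ℕ) → (k : ℕ) → X × X → ((Fin (k + 1) → X × X) → ℝ) → ℝ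
  | _, 0, z, F => F fun _ => z
  | p, k + 1, z, F =>
      ∫ w : X × X,
        H (p + 1) z.1 w.1 * H (p + 1) z.2 w.2 *
          chainE (p + 1) k w (fun path => F (Fin.cons z path)) ∂(lam.prod lam)

end FK

open MeasureTheory ENNReal Filter Topology

namespace FK

variable {X Y : Type} [MeasurableSpace X] [MeasurableSpace Y]

theorem measurable_snoc {n : ℕ} {z : Y → Fin n → X} {y : Y → X} (hz : Measurable z)
    (hy : Measurable y) : Measurable fun a => (Fin.snoc (z a) (y a) : Fin (n + 1) → X) := by
  refine measurable_pi_lambda _ (Fin.lastCases ?_ fun j => ?_)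
  · simpa only [Fin.snoc_last] using hy
  · simpa only [Fin.snoc_castSucc] using measurable_pi_iff.1 hz j

theorem measurable_Fpath {lam : Measure X} [SFinite lam] {G : ℕ → X → ℝ} {H : ℕ → X → X → ℝ}
    (hG : ∀ n, Measurable (G n)) (hH : ∀ n, Measurable (Function.uncurry (H n))) (k p : ℕ)
    {g : Y → X} (hg : Measurable g) {F : Y → (Fin k → X) → ℝ}
    (hF : Measurable (Function.uncurry F)) :
    Measurable fun a => Fpath lam G H p k (g a) (F a) := by
  induction k generalizing p Y with
  | zero => exact hF.comp (measurable_id.prodMk measurable_const)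
  | succ k ih =>
    have hF' : Measurable (Function.uncurry
        fun (b : Y × X) (z : Fin k → X) => F b.1 (Fin.cons b.2 z)) := by
      have hcons : Measurable fun c : (Y × X) × (Fin k → X) =>
          (Fin.cons c.1.2 c.2 : Fin (k + 1) → X) := by
        refine measurable_pi_lambda _ (Fin.cases ?_ fun j => ?_)
        · simpa only [Fin.cons_zero] using measurable_fst.snd
        · simpa only [Fin.cons_succ] using measurable_pi_iff.1 measurable_snd j
      exact hF.comp (measurable_fst.fst.prodMk hcons)
    have hint : Measurable fun b : Y × X =>
        H (p + 1) (g b.1) b.2 * Fpath lam G H (p + 1) k b.2 fun z => F b.1 (Fin.cons b.2 z) :=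
      ((hH (p + 1)).comp ((hg.comp measurable_fst).prodMk measurable_snd)).mul
        (ih (p + 1) measurable_snd hF')
    exact ((hG p).comp hg).mul hint.stronglyMeasurable.integral_prod_right'.measurable

theorem measurable_Bpath {m : ℕ → Measure X} [∀ n, SFinite (m n)] {G : ℕ → X → ℝ}
    {H : ℕ → X → X → ℝ} (hG : ∀ n, Measurable (G n))
    (hH : ∀ n, Measurable (Function.uncurry (H n))) (n : ℕ)
    {g : Y → X} (hg : Measurable g) {F : Y → (Fin n → X) → ℝ}
    (hF : Measurable (Function.uncurry F)) :
    Measurable fun a => Bpath G H m n (g a) (F a) := by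
  induction n generalizing Y with
  | zero => exact hF.comp (measurable_id.prodMk measurable_const)
  | succ n ih =>
    have hF' : Measurable (Function.uncurry
        fun (b : Y × X) (z : Fin n → X) => F b.1 (Fin.snoc z b.2)) :=
      hF.comp (measurable_fst.fst.prodMk (measurable_snoc measurable_snd measurable_fst.snd))
    have hweight : Measurable fun b : Y × X => G n b.2 * H (n + 1) b.2 (g b.1) :=
      ((hG n).comp measurable_snd).mul
        ((hH (n + 1)).comp (measurable_snd.prodMk (hg.comp measurable_fst)))
    have hint : Measurable fun b : Y × X =>
        G n b.2 * H (n + 1) b.2 (g b.1) * Bpath G H m n b.2 fun z => F b.1 (Fin.snoc z b.2) :=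
      hweight.mul (ih measurable_snd hF')
    exact hint.stronglyMeasurable.integral_prod_right'.measurable.div
      hweight.stronglyMeasurable.integral_prod_right'.measurable

theorem measurable_Dop {lam : Measure X} [SFinite lam] {m : ℕ → Measure X} [∀ n, SFinite (m n)]
    {G : ℕ → X → ℝ} {H : ℕ → X → X → ℝ} (hG : ∀ n, Measurable (G n))
    (hH : ∀ n, Measurable (Function.uncurry (H n))) (p n : ℕ)
    {F : (Fin (n + 1) → X) → ℝ} (hF : Measurable F) : Measurable (Dop lam G H m p n F) := by
  by_cases h : p ≤ n
  · unfold Dop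
    simp only [h, ↓reduceDIte]
    refine measurable_Bpath hG hH p measurable_id
      (measurable_Fpath hG hH (n - p) p measurable_fst (hF.comp (measurable_pi_lambda _ fun i => ?_)))
    refine Fin.addCases (fun j => ?_) (fun j => ?_)
      (Fin.cast (by omega : n + 1 = p + 1 + (n - p)) i)
    · simpa only [Fin.append_left] using measurable_pi_iff.1
        (measurable_snoc (measurable_fst.snd (f := fun c : (X × (Fin p → X)) × _ => c.1))
          measurable_fst.fst) j
    · simpa only [Fin.append_right] using measurable_pi_iff.1 measurable_snd j
  · have hzero : Dop lam G H m p n F = fun _ => 0 := funext fun _ => dif_neg h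
    exact hzero ▸ measurable_const

theorem sFinite_gammaM {lam mu : Measure X} [SFinite lam] [SFinite mu] {G : ℕ → X → ℝ}
    {H : ℕ → X → X → ℝ} (hH : ∀ n, Measurable (Function.uncurry (H n))) (n : ℕ) :
    SFinite (gammaM lam mu G H n) := by
  induction n with
  | zero => assumption
  | succ n ih =>
    have hmeas : Measurable (Function.uncurry fun x y => ENNReal.ofReal (H (n + 1) x y)) :=
      (hH (n + 1)).ennreal_ofReal
    let κ := ProbabilityTheory.Kernel.withDensity (ProbabilityTheory.Kernel.const X lam)
      fun x y => ENNReal.ofReal (H (n + 1) x y)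
    have hκ : (fun x => lam.withDensity fun y => ENNReal.ofReal (H (n + 1) x y)) = κ := by
      ext1 x
      rw [ProbabilityTheory.Kernel.withDensity_apply _ hmeas,
        ProbabilityTheory.Kernel.const_apply]
    have : ProbabilityTheory.IsSFiniteKernel κ :=
      ProbabilityTheory.Kernel.IsSFiniteKernel.withDensity _ fun _ _ => ENNReal.ofReal_ne_top
    rw [gammaM, hκ]
    infer_instance

theorem sFinite_eta {lam mu : Measure X} [SFinite lam] [SFinite mu] {G : ℕ → X → ℝ}
    {H : ℕ → X → X → ℝ} (hH : ∀ n, Measurable (Function.uncurry (H n))) (n : ℕ) :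
    SFinite (eta lam mu G H n) := by
  have := sFinite_gammaM (lam := lam) (mu := mu) (G := G) hH n
  unfold eta
  infer_instance

end FK

theorem tensorized_centered_term_representation
    {X : Type} [MeasurableSpace X] (lam mu : Measure X) [SigmaFinite lam]
    [IsProbabilityMeasure mu]
    (G : ℕ → X → ℝ) (H : ℕ → X → X → ℝ)
    (hGmeas : ∀ n, Measurable (G n)) (hGnonneg : ∀ n x, 0 ≤ G n x)
    (hHmeas : ∀ n, Measurable (Function.uncurry (H n))) (hHnonneg : ∀ n x y, 0 ≤ H n x y)
    (hHdens : ∀ n, 1 ≤ n → ∀ x, ∫ y, H n x y ∂lam = 1)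
    (n p : ℕ) (hpn : p ≤ n) (F : (Fin (n + 1) → X) → ℝ) (hFmeas : Measurable F)
    (hFbdd : ∃ C : ℝ, ∀ ω, |F ω| ≤ C) (x : X)
    (hD1x : 0 < FK.Dop lam G H (FK.eta lam mu G H) p n (fun _ => 1) x)
    (hD1eta : 0 < FK.etaI lam mu G H p (FK.Dop lam G H (FK.eta lam mu G H) p n fun _ => 1))
    :
    FK.Dop lam G H (FK.eta lam mu G H) p n F x / FK.Dop lam G H (FK.eta lam mu G H) p n (fun _ => 1) x -
      FK.etaI lam mu G H p (FK.Dop lam G H (FK.eta lam mu G H) p n F) /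
        FK.etaI lam mu G H p (FK.Dop lam G H (FK.eta lam mu G H) p n fun _ => 1) =
      ((∫ z : X × X, FK.Dop lam G H (FK.eta lam mu G H) p n F z.1 * FK.Dop lam G H (FK.eta lam mu G H) p n (fun _ => 1) z.2
          ∂((Measure.dirac x).prod (FK.eta lam mu G H p))) -
        ∫ z : X × X, FK.Dop lam G H (FK.eta lam mu G H) p n F z.1 * FK.Dop lam G H (FK.eta lam mu G H) p n (fun _ => 1) z.2
          ∂((FK.eta lam mu G H p).prod (Measure.dirac x))) /
        (FK.etaI lam mu G H p (FK.Dop lam G H (FK.eta lam mu G H) p n fun _ => 1) * FK.Dop lam G H (FK.eta lam mu G H) p n (fun _ => 1) x) := by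
  have hsf : ∀ q, SFinite (FK.eta lam mu G H q) := FK.sFinite_eta hHmeas
  have hmF := FK.measurable_Dop (lam := lam) (m := FK.eta lam mu G H) hGmeas hHmeas p n hFmeas
  have hm1 := FK.measurable_Dop (lam := lam) (m := FK.eta lam mu G H) hGmeas hHmeas p n
    (measurable_const (a := (1 : ℝ)))
  rw [integral_prod_mul, integral_prod_mul, integral_dirac' _ _ hmF.stronglyMeasurable,
    integral_dirac' _ _ hm1.stronglyMeasurable, div_sub_div _ _ hD1x.ne' hD1eta.ne']
  unfold FK.etaI
  ring
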